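/- For a line segment s of length L in ℝ³, the μ-measure of the set of planes intersecting s equals πL, where μ is the isometry-invariant measure on planes given by the product of spherical surface measure on S² and Lebesgue measure in the (direction, distance) parametrization. -/

import Mathlib

open MeasureTheory
open scoped RealInnerProductSpace

noncomputable section

/-- Three-dimensional Euclidean space. -/
abbrev E3 := EuclideanSpace ℝ (Fin 3)

/-- Parameter space for affine planes in `ℝ³`: a unit normal direction `u ∈ S²`
together with a distance `ρ ∈ ℝ` from the origin. -/
abbrev PlaneParam := Metric.sphere (0 : E3) 1 × ℝ

/-- The plane `{x : ⟨x, u⟩ = ρ}` associated with a parameter pair `(u, ρ)`. -/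
def planeOf (q : PlaneParam) : Set E3 := {x | ⟪x, (q.1 : E3)⟫ = q.2}

/-- The isometry-invariant measure `μ` on planes (in the parametrization above):
the product of the spherical surface measure on `S²` and Lebesgue measure on `(0, ∞)`. -/
def muPlanes : Measure PlaneParam :=
  ((volume : Measure E3).toSphere).prod (volume.restrict (Set.Ioi (0 : ℝ)))

/-- Length of the positive part of the projected interval. -/
def lenF (a b x : E3) : ℝ := max 0 (max ⟪a, x⟫ ⟪b, x⟫) - max 0 (min ⟪a, x⟫ ⟪b, x⟫)

lemma restrict_uIcc (p q : ℝ) : (volume.restrict (Set.Ioi (0 : ℝ))) (Set.uIcc p q) =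
    ENNReal.ofReal (max 0 (max p q) - max 0 (min p q)) := by
  rw [Measure.restrict_congr_set (Ioi_ae_eq_Ici (μ := volume) (a := (0 : ℝ))),
    Measure.restrict_apply measurableSet_uIcc]
  have : Set.uIcc p q ∩ Set.Ici 0 = Set.Icc (max 0 (min p q)) (max p q) := by
    ext x
    simp only [Set.uIcc, Set.mem_inter_iff, Set.mem_Icc, Set.mem_Ici, max_le_iff]
    tauto
  rw [this, Real.volume_Icc]
  rcases le_total 0 (max p q) with h | h
  · rw [max_eq_right h]
  · rw [ENNReal.ofReal_of_nonpos, ENNReal.ofReal_of_nonpos]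
    · rw [max_eq_left h]; linarith [le_max_left 0 (min p q)]
    · linarith [le_max_left 0 (min p q)]

lemma radial : ∫ r : Set.Ioi (0 : ℝ), (r : ℝ) * Real.exp (-(r : ℝ) ^ 2) ∂(Measure.volumeIoiPow 2)
    = 1 / 2 := by
  rw [Measure.volumeIoiPow, integral_withDensity_eq_integral_toReal_smul (by fun_prop)
    (by simp)]
  have h := integral_subtype_comap (μ := (volume : Measure ℝ)) (measurableSet_Ioi (a := (0 : ℝ)))
    (fun r : ℝ => (ENNReal.ofReal (r ^ 2)).toReal • (r * Real.exp (-r ^ 2)))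
  rw [h]
  have h2 := integral_rpow_mul_exp_neg_rpow (p := 2) (q := 3) (by norm_num) (by norm_num)
  have h3 : Real.Gamma ((3 + 1) / 2) = 1 := by
    norm_num [Real.Gamma_two]
  rw [h3] at h2
  rw [← mul_one (1 / 2 : ℝ), ← h2]
  refine setIntegral_congr_fun measurableSet_Ioi fun r hr => ?_
  have : (r : ℝ) ^ (3 : ℝ) = r ^ 3 := by exact_mod_cast Real.rpow_natCast r 3
  have h4 : (r : ℝ) ^ (2 : ℝ) = r ^ 2 := by exact_mod_cast Real.rpow_natCast r 2
  simp only [this, h4, smul_eq_mul, ENNReal.toReal_ofReal (sq_nonneg r)]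
  ring

lemma polar (F : E3 → ℝ) (hF : ∀ (r : ℝ) (x : E3), 0 < r → F (r • x) = r * F x) :
    ∫ x : E3, F x * Real.exp (-‖x‖ ^ 2) =
      (∫ u : Metric.sphere (0 : E3) 1, F u ∂((volume : Measure E3).toSphere)) * (1 / 2) := by
  have hd : Module.finrank ℝ E3 - 1 = 2 := by simp
  have hmp := (volume : Measure E3).measurePreserving_homeomorphUnitSphereProd
  rw [hd] at hmp
  rw [← radial, ← integral_prod_mul (fun u : Metric.sphere (0 : E3) 1 => F u)
    (fun r : Set.Ioi (0 : ℝ) => (r : ℝ) * Real.exp (-(r : ℝ) ^ 2)),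
    ← hmp.integral_comp (Homeomorph.measurableEmbedding _)]
  have h0 : ∫ x : E3, F x * Real.exp (-‖x‖ ^ 2) =
      ∫ x in ({0}ᶜ : Set E3), F x * Real.exp (-‖x‖ ^ 2) := by
    rw [restrict_compl_singleton]
  rw [h0, ← integral_subtype_comap (measurableSet_singleton _).compl]
  refine integral_congr_ae (Filter.Eventually.of_forall fun x => ?_)
  have hx : (0 : ℝ) < ‖(x : E3)‖ := norm_pos_iff.2 x.2
  simp only [homeomorphUnitSphereProd_apply_snd_coe, homeomorphUnitSphereProd_apply_fst_coe]
  rw [hF _ _ (inv_pos.2 hx)]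
  field_simp

lemma gauss_abs : ∫ x : ℝ, |x| * Real.exp (-x ^ 2) = 1 := by
  have h := integral_comp_abs (f := fun x : ℝ => x * Real.exp (-x ^ 2))
  simp only [sq_abs] at h
  rw [h]
  have h2 := integral_rpow_mul_exp_neg_rpow (p := 2) (q := 1) (by norm_num) (by norm_num)
  norm_num at h2
  rw [h2]; norm_num

lemma gauss_one : ∫ x : ℝ, Real.exp (-x ^ 2) = √Real.pi := by
  simpa using integral_gaussian 1

lemma gauss3 (v : E3) : ∫ x : E3, |⟪v, x⟫| * Real.exp (-‖x‖ ^ 2) = Real.pi * ‖v‖ := by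
  by_cases hv : v = 0
  · simp [hv]
  have hn : ‖v‖ ≠ 0 := norm_ne_zero_iff.2 hv
  obtain ⟨B, hB⟩ := Orthonormal.exists_orthonormalBasis_extension_of_card_eq (𝕜 := ℝ) (E := E3)
    (ι := Fin 3) (by simp) (v := fun _ => ‖v‖⁻¹ • v) (s := {0}) (by
      rw [orthonormal_iff_ite]
      rintro ⟨i, hi⟩ ⟨j, hj⟩
      obtain rfl : i = 0 := hi
      obtain rfl : j = 0 := hj
      have h1 : ‖(‖v‖⁻¹ • v)‖ = 1 := by
        rw [norm_smul, norm_inv, norm_norm, inv_mul_cancel₀ hn]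
      simp [h1])
  have hB0 : v = ‖v‖ • B 0 := by rw [hB 0 rfl]; simp [hn]
  have hmp := B.measurePreserving_repr_symm.comp (PiLp.volume_preserving_toLp (Fin 3))
  have hemb : MeasurableEmbedding (B.repr.symm ∘ (@WithLp.toLp 2 (Fin 3 → ℝ))) :=
    (B.repr.symm.toHomeomorph.measurableEmbedding).comp
      (MeasurableEquiv.toLp 2 (Fin 3 → ℝ)).measurableEmbedding
  rw [← hmp.integral_comp hemb]
  let f : Fin 3 → ℝ → ℝ := ![fun t => |t| * Real.exp (-t ^ 2), fun t => Real.exp (-t ^ 2),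
    fun t => Real.exp (-t ^ 2)]
  have key : ∀ y : Fin 3 → ℝ, |⟪v, (B.repr.symm ∘ (@WithLp.toLp 2 (Fin 3 → ℝ))) y⟫| *
      Real.exp (-‖(B.repr.symm ∘ (@WithLp.toLp 2 (Fin 3 → ℝ))) y‖ ^ 2) =
      ‖v‖ * ∏ i, f i (y i) := by
    intro y
    have h1 : ⟪v, B.repr.symm (WithLp.toLp 2 y)⟫ = ‖v‖ * y 0 := by
      conv_lhs => rw [hB0]
      rw [inner_smul_left, ← B.repr_apply_apply]
      simp
    have h2 : ‖B.repr.symm (WithLp.toLp 2 y)‖ ^ 2 = y 0 ^ 2 + y 1 ^ 2 + y 2 ^ 2 := by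
      rw [LinearIsometryEquiv.norm_map, EuclideanSpace.norm_sq_eq, Fin.sum_univ_three]
      simp
    simp only [Function.comp_apply, h1, h2, Fin.prod_univ_three, f, abs_mul, abs_norm]
    simp only [Matrix.cons_val]
    rw [neg_add, neg_add, Real.exp_add, Real.exp_add]
    ring
  simp only [key]
  rw [integral_const_mul, integral_fintype_prod_volume_eq_prod, Fin.prod_univ_three]
  simp only [f, Matrix.cons_val]
  rw [gauss_abs, gauss_one, one_mul, Real.mul_self_sqrt Real.pi_pos.le, mul_comm]

lemma lenF_cont (a b : E3) : Continuous (lenF a b) := by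
  unfold lenF; fun_prop

lemma lenF_smul (a b : E3) (r : ℝ) (x : E3) (hr : 0 < r) :
    lenF a b (r • x) = r * lenF a b x := by
  have h : ∀ s : ℝ, max 0 (r * s) = r * max 0 s := fun s => by
    rw [mul_max_of_nonneg _ _ hr.le, mul_zero]
  simp only [lenF, inner_smul_right]
  rw [← mul_max_of_nonneg _ _ hr.le, ← mul_min_of_nonneg _ _ hr.le, h, h, mul_sub]

lemma lenF_nonneg (a b x : E3) : 0 ≤ lenF a b x :=
  sub_nonneg.2 (max_le_max le_rfl (min_le_max))

lemma lenF_add (a b x : E3) : lenF a b x + lenF a b (-x) = |⟪b - a, x⟫| := by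
  simp only [lenF, inner_neg_right, inner_sub_left]
  generalize (⟪a, x⟫ : ℝ) = p
  generalize (⟪b, x⟫ : ℝ) = q
  rw [max_neg_neg, min_neg_neg]
  have h : ∀ s : ℝ, max 0 s - max 0 (-s) = s := fun s => by
    rcases le_total 0 s with h | h
    · rw [max_eq_right h, max_eq_left (by linarith)]; ring
    · rw [max_eq_left h, max_eq_right (by linarith)]; ring
  have h1 := h (max p q)
  have h2 := h (min p q)
  have h3 := max_sub_min_eq_abs p q
  linarith

lemma int_lenF (a b : E3) :
    ∫ u : Metric.sphere (0 : E3) 1, lenF a b u ∂((volume : Measure E3).toSphere) =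
      Real.pi * dist a b := by
  have e1 := polar (lenF a b) (lenF_smul a b)
  have e2 := polar (fun x => lenF a b (-x)) (fun r x hr => by
    rw [← smul_neg, lenF_smul a b r _ hr])
  have e3 := polar (fun x => |⟪b - a, x⟫|) (fun r x hr => by
    rw [inner_smul_right, abs_mul, abs_of_pos hr])
  rw [gauss3] at e3
  have e4 := integral_neg_eq_self (fun x : E3 => lenF a b x * Real.exp (-‖x‖ ^ 2)) volume
  simp only [norm_neg] at e4
  have i1 : Integrable (fun u : Metric.sphere (0 : E3) 1 => lenF a b u)
      ((volume : Measure E3).toSphere) :=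
    ((lenF_cont a b).comp continuous_subtype_val).integrable_of_hasCompactSupport
      (HasCompactSupport.of_compactSpace _)
  have i2 : Integrable (fun u : Metric.sphere (0 : E3) 1 => lenF a b (-u))
      ((volume : Measure E3).toSphere) :=
    ((lenF_cont a b).comp continuous_subtype_val.neg).integrable_of_hasCompactSupport
      (HasCompactSupport.of_compactSpace _)
  simp only [← lenF_add] at e3
  rw [integral_add i1 i2] at e3
  rw [dist_comm, dist_eq_norm]
  linarith

lemma set_eq (a b : E3) : {q : PlaneParam | (planeOf q ∩ segment ℝ a b).Nonempty} =
    {q : PlaneParam | q.2 ∈ Set.uIcc ⟪a, (q.1 : E3)⟫ ⟪b, (q.1 : E3)⟫} := by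
  ext q
  have h := image_segment ℝ (innerₛₗ ℝ (q.1 : E3)).toAffineMap a b
  rw [segment_eq_uIcc] at h
  simp only [LinearMap.coe_toAffineMap, innerₛₗ_apply_apply] at h
  simp only [Set.mem_ofPred_eq, real_inner_comm (q.1 : E3)]
  rw [← h]
  constructor
  · rintro ⟨x, hx, hs⟩
    exact ⟨x, hs, by rw [← hx]; simp [real_inner_comm]⟩
  · rintro ⟨x, hs, hx⟩
    exact ⟨x, by rw [planeOf, Set.mem_ofPred_eq, ← hx]; simp [real_inner_comm], hs⟩

/-- for a line segment `s = [a, b]` of length `L = dist a b` in `ℝ³`,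
the `μ`-measure of the set of planes intersecting `s` equals `π * L`. -/
theorem stmt2 (a b : E3) :
    muPlanes {q : PlaneParam | (planeOf q ∩ segment ℝ a b).Nonempty} =
      ENNReal.ofReal (Real.pi * dist a b) := by
  rw [set_eq, muPlanes, Measure.prod_apply, ← int_lenF, ofReal_integral_eq_lintegral_ofReal]
  · refine lintegral_congr fun u => ?_
    exact restrict_uIcc ⟪a, (u : E3)⟫ ⟪b, (u : E3)⟫
  · exact ((lenF_cont a b).comp continuous_subtype_val).integrable_of_hasCompactSupport
      (HasCompactSupport.of_compactSpace _)
  · exact Filter.Eventually.of_forall fun u => lenF_nonneg a b u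
  · apply IsClosed.measurableSet
    simp only [Set.uIcc, Set.mem_Icc, Set.ofPred_and]
    exact (isClosed_le (by fun_prop) (by fun_prop)).inter (isClosed_le (by fun_prop) (by fun_prop))
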